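/- Let n ≥ 1 be an integer, 0 < q < 1, and let π have the Mallows distribution μ_{n,q}. Let 0 ≤ t < n and let g ⊆ {1,…,t}² be any set with P[Γ_π ∩ ({1,…,t}×{1,…,t}) = g] > 0, and set k := t − |g| (so that κ_t(π) = k on the conditioning event). Then, conditionally on {Γ_π ∩ ({1,…,t}×{1,…,t}) = g}: P[κ_{t+1}(π) = k−1] = ((1−q^k)/(1−q^{n−t}))²; P[κ_{t+1}(π) = k] = ((q^k − q^{n−t})/(1−q^{n−t})) · ((2 − q^k − q^{k+1})/(1−q^{n−t})); and P[κ_{t+1}(π) = k+1] = ((q^k − q^{n−t})/(1−q^{n−t})) · ((q^{k+1} − q^{n−t})/(1−q^{n−t})). In particular |κ_{t+1}(π) − κ_t(π)| ≤ 1 almost surely. -/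

import Mathlib

open Finset
open scoped Classical BigOperators

noncomputable section

/-- Number of inversions of a permutation of `Fin n` (0-indexed positions). -/
def invCount (n : ℕ) (π : Equiv.Perm (Fin n)) : ℕ :=
  ((Finset.univ : Finset (Fin n × Fin n)).filter
    (fun p => p.1 < p.2 ∧ π p.2 < π p.1)).card

/-- Normalizing constant of the Mallows distribution. -/
def mallowsZ (n : ℕ) (q : ℝ) : ℝ :=
  ∑ σ : Equiv.Perm (Fin n), q ^ invCount n σ

/-- Mallows probability of an individual permutation. -/
def mallowsP (n : ℕ) (q : ℝ) (π : Equiv.Perm (Fin n)) : ℝ :=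
  q ^ invCount n π / mallowsZ n q

/-- Expectation of a real-valued functional under the Mallows distribution. -/
def mExp (n : ℕ) (q : ℝ) (X : Equiv.Perm (Fin n) → ℝ) : ℝ :=
  ∑ π : Equiv.Perm (Fin n), mallowsP n q π * X π

/-- Probability of an event under the Mallows distribution. -/
def mProb (n : ℕ) (q : ℝ) (A : Equiv.Perm (Fin n) → Prop) : ℝ :=
  ∑ π : Equiv.Perm (Fin n), if A π then mallowsP n q π else 0

/-- Conditional probability of `A` given `B` under the Mallows distribution. -/
def mCondProb (n : ℕ) (q : ℝ) (A B : Equiv.Perm (Fin n) → Prop) : ℝ :=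
  mProb n q (fun π => A π ∧ B π) / mProb n q B

/-- The graph `Γ_π = {(s, π(s))}` of a permutation, as a subset of `Fin n × Fin n`. -/
def graphP (n : ℕ) (π : Equiv.Perm (Fin n)) : Finset (Fin n × Fin n) :=
  Finset.univ.filter (fun p => π p.1 = p.2)

/-- The arc chain `κ_t(π) = |{i ∈ {1,…,t} : π(i) > t}|` (here expressed with
0-indexed positions and values of a permutation of `Fin n`). -/
def kappa (n t : ℕ) (π : Equiv.Perm (Fin n)) : ℕ :=
  (Finset.univ.filter (fun i : Fin n => (i : ℕ) < t ∧ t ≤ ((π i : ℕ)))).card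

/-- Rank of the value at position `j` among the values at positions `≥ T`. -/
def rk {n : ℕ} (T : Fin n) (π : Equiv.Perm (Fin n)) (j : Fin n) : ℕ :=
  (univ.filter (fun i : Fin n => T ≤ i ∧ π i < π j)).card

/-- Unnormalised weight of an event. -/
def wt (n : ℕ) (q : ℝ) (A : Equiv.Perm (Fin n) → Prop) : ℝ :=
  ∑ π : Equiv.Perm (Fin n), if A π then q ^ invCount n π else 0

lemma rk_lt_of_lt {n : ℕ} (T : Fin n) (π : Equiv.Perm (Fin n)) {i j : Fin n} (hi : T ≤ i)
    (h : π i < π j) : rk T π i < rk T π j := by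
  apply Finset.card_lt_card
  rw [Finset.ssubset_iff_of_subset]
  · exact ⟨i, by simp [hi, h], by simp⟩
  · intro x hx
    simp only [mem_filter, mem_univ, true_and] at hx ⊢
    exact ⟨hx.1, hx.2.trans h⟩

lemma rk_inj {n : ℕ} (T : Fin n) (π : Equiv.Perm (Fin n)) {i j : Fin n} (hi : T ≤ i)
    (hj : T ≤ j) (h : rk T π i = rk T π j) : i = j := by
  rcases lt_trichotomy (π i) (π j) with h' | h' | h'
  · have := rk_lt_of_lt T π hi h'
    omega
  · exact π.injective h'
  · have := rk_lt_of_lt T π hj h'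
    omega

lemma card_ge {n : ℕ} (T : Fin n) :
    (univ.filter (fun i : Fin n => T ≤ i)).card = n - T := by
  have : univ.filter (fun i : Fin n => T ≤ i) = Finset.Ici T := by ext; simp
  rw [this, Fin.card_Ici]

lemma rk_lt {n : ℕ} (T : Fin n) (π : Equiv.Perm (Fin n)) {j : Fin n} (hj : T ≤ j) :
    rk T π j < n - T := by
  rw [← card_ge T]
  apply Finset.card_lt_card
  rw [Finset.ssubset_iff_of_subset]
  · exact ⟨j, by simp [hj], by simp⟩
  · intro x hx
    simp only [mem_filter, mem_univ, true_and] at hx ⊢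
    exact hx.1

lemma exists_rk {n : ℕ} (T : Fin n) (π : Equiv.Perm (Fin n)) (r : ℕ) (hr : r < n - T) :
    ∃ j, T ≤ j ∧ rk T π j = r := by
  have h : (univ.filter (fun i : Fin n => T ≤ i)).image (rk T π) = Finset.range (n - T) := by
    apply Finset.eq_of_subset_of_card_le
    · intro x hx
      simp only [mem_image, mem_filter, mem_univ, true_and] at hx
      obtain ⟨j, hj, rfl⟩ := hx
      exact Finset.mem_range.2 (rk_lt T π hj)
    · rw [Finset.card_image_of_injOn, card_ge, Finset.card_range]
      intro i hi j hj hij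
      simp only [coe_filter, mem_univ, true_and, Set.mem_ofPred_eq] at hi hj
      exact rk_inj T π hi hj hij
  have : r ∈ Finset.range (n - T) := Finset.mem_range.2 hr
  rw [← h] at this
  simpa using this

lemma swap_ge {n : ℕ} {T j : Fin n} (hj : T ≤ j) (i : Fin n) :
    T ≤ Equiv.swap T j i ↔ T ≤ i := by
  rw [Equiv.swap_apply_def]
  split_ifs <;> simp_all

lemma rk_swap {n : ℕ} (T : Fin n) (π : Equiv.Perm (Fin n)) {j : Fin n} (hj : T ≤ j) (i : Fin n) :
    rk T (π * Equiv.swap T j) i = rk T π (Equiv.swap T j i) := by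
  unfold rk
  apply Finset.card_bij' (fun a _ => Equiv.swap T j a) (fun a _ => Equiv.swap T j a)
  · intro a ha
    rw [mem_filter] at ha ⊢
    simpa [swap_ge hj] using ha
  · intro a ha
    rw [mem_filter] at ha ⊢
    simpa [swap_ge hj] using ha
  · simp
  · simp

lemma inv_swap {n : ℕ} (T : Fin n) (π : Equiv.Perm (Fin n)) {j : Fin n} (hj : T ≤ j)
    (h : rk T π j = rk T π T + 1) :
    invCount n (π * Equiv.swap T j) = invCount n π + 1 := by
  have hne : T ≠ j := by rintro rfl; omega
  have hTj : T < j := lt_of_le_of_ne hj hne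
  have hlt : π T < π j := by
    by_contra hc
    have hne' : π j ≠ π T := fun h => hne (π.injective h).symm
    have := rk_lt_of_lt T π hj (lt_of_le_of_ne (not_lt.1 hc) hne')
    omega
  have key : ∀ b, T ≤ b → π b < π j → b ≠ T → π b < π T := by
    have : insert T (univ.filter (fun i : Fin n => T ≤ i ∧ π i < π T))
        = univ.filter (fun i : Fin n => T ≤ i ∧ π i < π j) := by
      apply Finset.eq_of_subset_of_card_le
      · intro x hx
        simp only [mem_insert, mem_filter, mem_univ, true_and] at hx ⊢
        rcases hx with rfl | hx
        · exact ⟨le_rfl, hlt⟩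
        · exact ⟨hx.1, hx.2.trans hlt⟩
      · rw [Finset.card_insert_of_notMem (by simp)]
        exact h.le
    intro b hb hbj hbT
    have hm : b ∈ univ.filter (fun i : Fin n => T ≤ i ∧ π i < π j) := by simp [hb, hbj]
    rw [← this] at hm
    simp [hbT] at hm
    exact hm.2
  have hmem : (T, j) ∈ (univ : Finset (Fin n × Fin n)).filter
      (fun p => p.1 < p.2 ∧ (π * Equiv.swap T j) p.2 < (π * Equiv.swap T j) p.1) := by
    rw [mem_filter]
    simp [hTj, hlt]
  unfold invCount
  rw [← Finset.card_erase_add_one hmem]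
  congr 1
  have hpi : ∀ a b, π a = π b → a = b := fun a b h => π.injective h
  have sw1 : Equiv.swap T j T = j := by simp
  have sw2 : Equiv.swap T j j = T := by simp
  have sw3 : ∀ a, a ≠ T → a ≠ j → Equiv.swap T j a = a := fun a h1 h2 =>
    Equiv.swap_apply_of_ne_of_ne h1 h2
  have swg := swap_ge hj
  have sws : ∀ a, Equiv.swap T j (Equiv.swap T j a) = a := by simp
  have mono : ∀ a b, T ≤ a → T ≤ b → a < b → (a, b) ≠ (T, j) →
      (π (Equiv.swap T j b) < π (Equiv.swap T j a) ↔ π b < π a) := by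
    intro a b ha hb hab hne2
    have hbT : b ≠ T := (lt_of_le_of_lt ha hab).ne'
    by_cases haT : a = T
    · subst haT
      have hbj : b ≠ j := by rintro rfl; exact hne2 rfl
      rw [sw1, sw3 b hbT hbj]
      exact ⟨fun h => key b hb h hbT, fun h => h.trans hlt⟩
    · by_cases haj : a = j
      · subst haj
        rw [sw2, sw3 b hbT hab.ne']
        exact ⟨fun h => h.trans hlt, fun h => key b hb h hbT⟩
      · rw [sw3 a haT haj]
        by_cases hbj : b = j
        · subst hbj
          rw [sw2]
          constructor
          · intro h
            by_contra hc
            have h1 : π a ≠ π b := fun h => haj (hpi _ _ h)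
            have := key a ha (lt_of_le_of_ne (not_lt.1 hc) h1) haT
            exact absurd h this.not_gt
          · exact fun h => hlt.trans h
        · rw [sw3 b hbT hbj]
  apply Finset.card_bij' (fun p _ => if p.1 < T then (p.1, Equiv.swap T j p.2) else p)
    (fun p _ => if p.1 < T then (p.1, Equiv.swap T j p.2) else p)
  · rintro ⟨a, b⟩ hp
    simp only [mem_erase, mem_filter, mem_univ, true_and] at hp ⊢
    simp only [Equiv.Perm.mul_apply] at hp ⊢
    obtain ⟨h1, h2, h3⟩ := hp
    by_cases haT : a < T
    · rw [if_pos haT]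
      rw [sw3 a haT.ne (haT.trans hTj).ne] at h3
      refine ⟨?_, h3⟩
      by_cases hb : T ≤ b
      · exact lt_of_lt_of_le haT ((swg b).2 hb)
      · rw [sw3 b (fun h => hb h.ge) (fun h => hb (h ▸ hj))]
        exact h2
    · rw [if_neg haT]
      have ha := not_lt.1 haT
      exact ⟨h2, (mono a b ha (ha.trans h2.le) h2 h1).1 h3⟩
  · rintro ⟨a, b⟩ hp
    simp only [mem_erase, mem_filter, mem_univ, true_and] at hp ⊢
    simp only [Equiv.Perm.mul_apply] at hp ⊢
    obtain ⟨h2, h3⟩ := hp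
    by_cases haT : a < T
    · rw [if_pos haT]
      refine ⟨fun h => haT.ne (Prod.ext_iff.1 h).1, ?_, ?_⟩
      · by_cases hb : T ≤ b
        · exact lt_of_lt_of_le haT ((swg b).2 hb)
        · rw [sw3 b (fun h => hb h.ge) (fun h => hb (h ▸ hj))]
          exact h2
      · simp only [sws]
        rw [sw3 a haT.ne (haT.trans hTj).ne]
        exact h3
    · rw [if_neg haT]
      have ha := not_lt.1 haT
      have h1 : (a, b) ≠ (T, j) := by
        intro h
        obtain ⟨rfl, rfl⟩ := Prod.ext_iff.1 h
        exact absurd h3 hlt.not_gt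
      exact ⟨h1, h2, (mono a b ha (ha.trans h2.le) h2 h1).2 h3⟩
  · rintro ⟨a, b⟩ hp
    by_cases haT : a < T <;> simp [haT]
  · rintro ⟨a, b⟩ hp
    by_cases haT : a < T <;> simp [haT]

lemma wt_filter (n : ℕ) (q : ℝ) (A : Equiv.Perm (Fin n) → Prop) :
    wt n q A = ∑ π ∈ univ.filter A, q ^ invCount n π := by
  unfold wt
  rw [Finset.sum_filter]

lemma wt_succ {n : ℕ} (q : ℝ) (T : Fin n) (P : Equiv.Perm (Fin n) → Prop)
    (hP : ∀ π j, T ≤ j → (P (π * Equiv.swap T j) ↔ P π)) (r : ℕ) (hr : r + 1 < n - T) :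
    wt n q (fun π => P π ∧ rk T π T = r + 1) = q * wt n q (fun π => P π ∧ rk T π T = r) := by
  rw [wt_filter, wt_filter, Finset.mul_sum]
  choose J hJ1 hJ2 using fun π => exists_rk T π r (by omega)
  choose K hK1 hK2 using fun π => exists_rk T π (r + 1) hr
  symm
  apply Finset.sum_bij' (fun π _ => π * Equiv.swap T (K π)) (fun π _ => π * Equiv.swap T (J π))
  · intro π hπ
    simp only [mem_filter, mem_univ, true_and] at hπ ⊢
    rw [hP π _ (hK1 π), rk_swap T π (hK1 π), Equiv.swap_apply_left]
    exact ⟨hπ.1, hK2 π⟩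
  · intro π hπ
    simp only [mem_filter, mem_univ, true_and] at hπ ⊢
    rw [hP π _ (hJ1 π), rk_swap T π (hJ1 π), Equiv.swap_apply_left]
    exact ⟨hπ.1, hJ2 π⟩
  · intro π hπ
    simp only [mem_filter, mem_univ, true_and] at hπ
    have : J (π * Equiv.swap T (K π)) = K π := by
      apply rk_inj T (π * Equiv.swap T (K π)) (hJ1 _) (hK1 _)
      rw [hJ2, rk_swap T π (hK1 π), Equiv.swap_apply_right, hπ.2]
    simp only [this]
    rw [mul_assoc, Equiv.swap_mul_self, mul_one]
  · intro π hπ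
    simp only [mem_filter, mem_univ, true_and] at hπ
    have : K (π * Equiv.swap T (J π)) = J π := by
      apply rk_inj T (π * Equiv.swap T (J π)) (hK1 _) (hJ1 _)
      rw [hK2, rk_swap T π (hJ1 π), Equiv.swap_apply_right, hπ.2]
    simp only [this]
    rw [mul_assoc, Equiv.swap_mul_self, mul_one]
  · intro π hπ
    simp only [mem_filter, mem_univ, true_and] at hπ
    rw [inv_swap T π (hK1 π) (by rw [hK2, hπ.2]), pow_succ, mul_comm]

lemma wt_split {n : ℕ} (q : ℝ) (A C : Equiv.Perm (Fin n) → Prop) :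
    wt n q A = wt n q (fun π => A π ∧ C π) + wt n q (fun π => A π ∧ ¬ C π) := by
  unfold wt
  rw [← Finset.sum_add_distrib]
  apply Finset.sum_congr rfl
  intro π _
  by_cases hA : A π <;> by_cases hC : C π <;> simp [hA, hC]

lemma wt_congr {n : ℕ} (q : ℝ) {A C : Equiv.Perm (Fin n) → Prop} (h : ∀ π, A π ↔ C π) :
    wt n q A = wt n q C := by
  have : A = C := funext fun π => propext (h π)
  rw [this]

lemma wt_false {n : ℕ} (q : ℝ) {A : Equiv.Perm (Fin n) → Prop} (h : ∀ π, ¬ A π) :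
    wt n q A = 0 := by
  unfold wt
  apply Finset.sum_eq_zero
  intro π _
  simp [h π]

lemma wt_lt {n : ℕ} (q : ℝ) (T : Fin n) (P : Equiv.Perm (Fin n) → Prop)
    (hP : ∀ π j, T ≤ j → (P (π * Equiv.swap T j) ↔ P π)) (c : ℕ) (hc : c ≤ n - T) :
    (1 - q) * wt n q (fun π => P π ∧ rk T π T < c)
      = (1 - q ^ c) * wt n q (fun π => P π ∧ rk T π T = 0) := by
  have hpow : ∀ r, r < n - T → wt n q (fun π => P π ∧ rk T π T = r)
      = q ^ r * wt n q (fun π => P π ∧ rk T π T = 0) := by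
    intro r
    induction r with
    | zero => intro _; simp
    | succ r ih =>
      intro hr
      rw [wt_succ q T P hP r hr, ih (by omega), pow_succ]
      ring
  induction c with
  | zero => rw [wt_false q (by simp)]; simp
  | succ c ih =>
    rw [wt_split q _ (fun π => rk T π T < c)]
    rw [wt_congr q (C := fun π => P π ∧ rk T π T < c), mul_add, ih (by omega),
      wt_congr q (A := fun π => (P π ∧ rk T π T < c + 1) ∧ ¬ rk T π T < c)
        (C := fun π => P π ∧ rk T π T = c), hpow c (by omega)]
    · ring
    · intro π
      constructor
      · rintro ⟨⟨h1, h2⟩, h3⟩; exact ⟨h1, by omega⟩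
      · rintro ⟨h1, h2⟩; exact ⟨⟨h1, by omega⟩, by omega⟩
    · intro π
      constructor
      · rintro ⟨⟨h1, h2⟩, h3⟩; exact ⟨h1, by omega⟩
      · rintro ⟨h1, h2⟩; exact ⟨⟨h1, by omega⟩, by omega⟩

lemma wt_main {n : ℕ} (q : ℝ) (h1 : q < 1) (T : Fin n) (P : Equiv.Perm (Fin n) → Prop)
    (hP : ∀ π j, T ≤ j → (P (π * Equiv.swap T j) ↔ P π)) (c : ℕ) (hc : c ≤ n - T) :
    (1 - q ^ (n - (T : ℕ))) * wt n q (fun π => P π ∧ rk T π T < c)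
      = (1 - q ^ c) * wt n q P := by
  have a := wt_lt q T P hP c hc
  have b := wt_lt q T P hP (n - T) le_rfl
  rw [wt_congr q (C := P) (fun π => ⟨fun h => h.1, fun h => ⟨h, rk_lt T π le_rfl⟩⟩)] at b
  have h : (1 - q) ≠ 0 := by linarith
  apply mul_left_cancel₀ h
  linear_combination (1 - q ^ (n - (T : ℕ))) * a - (1 - q ^ c) * b

/-- Number of positions `≥ T` with value `< c`. -/
def low {n : ℕ} (T : Fin n) (c : ℕ) (π : Equiv.Perm (Fin n)) : ℕ :=
  (univ.filter (fun i : Fin n => T ≤ i ∧ (π i : ℕ) < c)).card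

lemma lt_iff_rk {n : ℕ} (T : Fin n) (c : ℕ) (π : Equiv.Perm (Fin n)) :
    (π T : ℕ) < c ↔ rk T π T < low T c π := by
  constructor
  · intro h
    apply Finset.card_lt_card
    rw [Finset.ssubset_iff_of_subset]
    · exact ⟨T, by simp [h], by simp⟩
    · intro x hx
      simp only [mem_filter, mem_univ, true_and, Fin.lt_def] at hx ⊢
      exact ⟨hx.1, hx.2.trans h⟩
  · intro h
    by_contra hc
    apply absurd h (not_lt.2 _)
    apply Finset.card_le_card
    intro x hx
    simp only [mem_filter, mem_univ, true_and, Fin.lt_def] at hx ⊢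
    exact ⟨hx.1, by omega⟩

lemma low_le {n : ℕ} (T : Fin n) (c : ℕ) (π : Equiv.Perm (Fin n)) : low T c π ≤ n - T := by
  rw [← card_ge T]
  apply Finset.card_le_card
  intro x hx
  simp only [mem_filter, mem_univ, true_and] at hx ⊢
  exact hx.1

lemma low_succ {n : ℕ} (T : Fin n) (π : Equiv.Perm (Fin n)) :
    low T (T + 1) π = low T T π + if T ≤ π.symm T then 1 else 0 := by
  unfold low
  split_ifs with h
  · have : univ.filter (fun i : Fin n => T ≤ i ∧ (π i : ℕ) < T + 1)
        = insert (π.symm T) (univ.filter (fun i : Fin n => T ≤ i ∧ (π i : ℕ) < T)) := by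
      ext x
      simp only [mem_insert, mem_filter, mem_univ, true_and]
      rw [Equiv.eq_symm_apply, Fin.ext_iff]
      constructor
      · rintro ⟨h1, h2⟩
        by_cases h3 : (π x : ℕ) = T
        · exact Or.inl h3
        · exact Or.inr ⟨h1, by omega⟩
      · rintro (h1 | h1)
        · refine ⟨?_, by omega⟩
          have : π x = T := Fin.ext h1
          rwa [← this, Equiv.symm_apply_apply, this] at h
        · exact ⟨h1.1, by omega⟩
    rw [this, Finset.card_insert_of_notMem (by simp)]
  · rw [add_zero]
    congr 1
    ext x
    simp only [mem_filter, mem_univ, true_and]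
    constructor
    · rintro ⟨h1, h2⟩
      refine ⟨h1, ?_⟩
      by_contra h3
      have : π x = T := Fin.ext (by omega)
      rw [← this, Equiv.symm_apply_apply, this] at h
      exact h h1
    · rintro ⟨h1, h2⟩
      exact ⟨h1, by omega⟩

lemma card_lt {n : ℕ} (T : Fin n) :
    (univ.filter (fun i : Fin n => (i : ℕ) < T)).card = T := by
  have : univ.filter (fun i : Fin n => (i : ℕ) < T) = Finset.Iio T := by
    ext; simp
  rw [this, Fin.card_Iio]

lemma kappa_add {n : ℕ} (T : Fin n) (π : Equiv.Perm (Fin n)) :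
    (univ.filter (fun i : Fin n => (i : ℕ) < T ∧ (π i : ℕ) < T)).card + kappa n T π = T := by
  unfold kappa
  conv_rhs => rw [← card_lt T]
  rw [← Finset.card_filter_add_card_filter_not (s := univ.filter (fun i : Fin n => (i : ℕ) < T))
    (fun i => (π i : ℕ) < T), Finset.filter_filter, Finset.filter_filter]
  simp only [not_lt]

lemma low_add {n : ℕ} (T : Fin n) (π : Equiv.Perm (Fin n)) :
    (univ.filter (fun i : Fin n => (i : ℕ) < T ∧ (π i : ℕ) < T)).card + low T T π = T := by
  have h : (univ.filter (fun i : Fin n => (π i : ℕ) < T)).card = T := by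
    conv_rhs => rw [← card_lt T]
    apply Finset.card_bij' (fun a _ => π a) (fun a _ => π.symm a) <;> simp
  conv_rhs => rw [← h]
  unfold low
  rw [← Finset.card_filter_add_card_filter_not (s := univ.filter (fun i : Fin n => (π i : ℕ) < T))
    (fun i => (i : ℕ) < T), Finset.filter_filter, Finset.filter_filter]
  simp only [not_lt, and_comm, Fin.le_def]

lemma kappa_succ {n : ℕ} (T : Fin n) (π : Equiv.Perm (Fin n)) :
    kappa n (T + 1) π + (if π.symm T < T then 1 else 0)
      = kappa n T π + if T < π T then 1 else 0 := by
  have hA : ∀ i : Fin n, ((i : ℕ) < T + 1 ∧ (T : ℕ) + 1 ≤ π i) ↔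
      (((i : ℕ) < T ∧ (T : ℕ) + 1 ≤ π i) ∨ (i = T ∧ T < π T)) := by
    intro i
    by_cases hi : i = T
    · subst hi; rw [Fin.lt_def]; simp only [true_and]; omega
    · have : (i : ℕ) ≠ T := fun h => hi (Fin.ext h)
      simp [hi]; omega
  have hB : ∀ i : Fin n, ((i : ℕ) < T ∧ (T : ℕ) ≤ π i) ↔
      (((i : ℕ) < T ∧ (T : ℕ) + 1 ≤ π i) ∨ (i = π.symm T ∧ π.symm T < T)) := by
    intro i
    by_cases hi : i = π.symm T
    · subst hi; rw [Fin.lt_def]; simp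
    · have : (π i : ℕ) ≠ T := fun h => hi (by rw [Equiv.eq_symm_apply]; exact Fin.ext h)
      simp [hi]; omega
  unfold kappa
  simp_rw [hA, hB, Finset.filter_or]
  rw [Finset.card_union_of_disjoint, Finset.card_union_of_disjoint]
  · have c1 : ∀ (x : Fin n) (p : Prop) [Decidable p],
        (univ.filter (fun i : Fin n => i = x ∧ p)).card = if p then 1 else 0 := by
      intro x p _
      by_cases hp : p <;> simp [hp, Finset.filter_eq']
    rw [c1, c1]
    ring
  · rw [Finset.disjoint_filter]
    rintro i _ h1 ⟨rfl, h2⟩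
    simp at h1
  · rw [Finset.disjoint_filter]
    rintro i _ h1 ⟨rfl, h2⟩
    simp at h1

/-- The conditioning event. -/
def ev (n t : ℕ) (g : Finset (Fin n × Fin n)) (π : Equiv.Perm (Fin n)) : Prop :=
  graphP n π ∩ Finset.univ.filter
    (fun p : Fin n × Fin n => (p.1 : ℕ) < t ∧ (p.2 : ℕ) < t) = g

lemma ev_iff (n t : ℕ) (g : Finset (Fin n × Fin n)) (π : Equiv.Perm (Fin n)) :
    ev n t g π ↔ ∀ a b : Fin n, (π a = b ∧ (a : ℕ) < t ∧ (b : ℕ) < t) ↔ (a, b) ∈ g := by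
  unfold ev graphP
  rw [Finset.ext_iff, Prod.forall]
  simp

lemma ev_swap {n : ℕ} (T : Fin n) (g : Finset (Fin n × Fin n)) (π : Equiv.Perm (Fin n))
    (j : Fin n) (hj : T ≤ j) : ev n T g (π * Equiv.swap T j) ↔ ev n T g π := by
  rw [ev_iff, ev_iff]
  apply forall_congr'; intro a
  apply forall_congr'; intro b
  have : (π * Equiv.swap T j) a = b ∧ (a : ℕ) < T ∧ (b : ℕ) < T ↔
      π a = b ∧ (a : ℕ) < T ∧ (b : ℕ) < T := by
    by_cases ha : a < T
    · rw [Equiv.Perm.mul_apply, Equiv.swap_apply_of_ne_of_ne ha.ne (ha.trans_le hj).ne]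
    · rw [Fin.lt_def] at ha
      simp [ha]
  rw [this]

lemma ev_card {n : ℕ} (T : Fin n) (g : Finset (Fin n × Fin n)) (π : Equiv.Perm (Fin n))
    (h : ev n T g π) :
    (univ.filter (fun i : Fin n => (i : ℕ) < T ∧ (π i : ℕ) < T)).card = g.card := by
  rw [ev_iff] at h
  apply Finset.card_bij' (fun a _ => (a, π a)) (fun p _ => p.1)
  · intro a ha
    simp only [mem_filter, mem_univ, true_and] at ha
    exact (h _ _).1 ⟨rfl, ha⟩
  · rintro ⟨a, b⟩ hp
    obtain ⟨rfl, h2⟩ := (h a b).2 hp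
    simpa using h2
  · simp
  · rintro ⟨a, b⟩ hp
    obtain ⟨rfl, h2⟩ := (h a b).2 hp
    rfl

lemma inv_symm (n : ℕ) (π : Equiv.Perm (Fin n)) : invCount n π.symm = invCount n π := by
  unfold invCount
  apply Finset.card_bij' (fun p _ => (π.symm p.2, π.symm p.1)) (fun p _ => (π p.2, π p.1)) <;>
    simp <;> tauto

lemma wt_symm {n : ℕ} (q : ℝ) (A : Equiv.Perm (Fin n) → Prop) :
    wt n q (fun π => A π.symm) = wt n q A := by
  unfold wt
  refine Finset.sum_bij' (fun π _ => π.symm) (fun π _ => π.symm) ?_ ?_ ?_ ?_ ?_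
  · intro _ _; exact mem_univ _
  · intro _ _; exact mem_univ _
  · intro _ _; rfl
  · intro _ _; rfl
  · intro π _
    simp only [inv_symm]

lemma ev_symm (n t : ℕ) (g : Finset (Fin n × Fin n)) (π : Equiv.Perm (Fin n)) :
    ev n t (g.map (Equiv.prodComm _ _).toEmbedding) π.symm ↔ ev n t g π := by
  rw [ev_iff, ev_iff, forall_comm]
  apply forall_congr'; intro a
  apply forall_congr'; intro b
  rw [Equiv.symm_apply_eq]
  simp
  tauto

lemma ev_low {n : ℕ} (T : Fin n) (g : Finset (Fin n × Fin n)) (π : Equiv.Perm (Fin n))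
    (h : ev n T g π) : low T T π = T - g.card := by
  have h1 := ev_card T g π h
  have h2 := low_add T π
  omega

lemma ev_kappa {n : ℕ} (T : Fin n) (g : Finset (Fin n × Fin n)) (π : Equiv.Perm (Fin n))
    (h : ev n T g π) : kappa n T π = T - g.card := by
  have h1 := ev_card T g π h
  have h2 := kappa_add T π
  omega

lemma wt_S {n : ℕ} (q : ℝ) (h1 : q < 1) (T : Fin n) (g : Finset (Fin n × Fin n))
    (k : ℕ) (hk : k = T - g.card) (hkm : k ≤ n - T) :
    (1 - q ^ (n - (T : ℕ))) * wt n q (fun π => ev n T g π ∧ π.symm T < T)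
      = (1 - q ^ k) * wt n q (ev n T g) := by
  have := wt_main q h1 T (ev n T (g.map (Equiv.prodComm _ _).toEmbedding)) (ev_swap T _) k hkm
  rw [← wt_symm q (ev n T (g.map _))] at this
  simp_rw [ev_symm] at this
  rw [← this, ← wt_symm]
  congr 1
  apply wt_congr
  intro π
  rw [Equiv.symm_symm]
  rw [← ev_symm, Equiv.symm_symm]
  apply and_congr_right
  intro h
  have h2 := ev_low T _ _ h
  rw [Finset.card_map, ← hk] at h2
  rw [← h2, ← lt_iff_rk, Fin.lt_def]

lemma mProb_eq {n : ℕ} (q : ℝ) (A : Equiv.Perm (Fin n) → Prop) :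
    mProb n q A = wt n q A / mallowsZ n q := by
  unfold mProb wt mallowsP
  rw [Finset.sum_div]
  apply Finset.sum_congr rfl
  intro π _
  split_ifs <;> simp

lemma mallowsZ_pos (n : ℕ) (q : ℝ) (h0 : 0 < q) : 0 < mallowsZ n q :=
  Finset.sum_pos (fun π _ => pow_pos h0 _) ⟨1, mem_univ _⟩

lemma mCond_eq {n : ℕ} (q : ℝ) (h0 : 0 < q) (A B : Equiv.Perm (Fin n) → Prop) :
    mCondProb n q A B = wt n q (fun π => A π ∧ B π) / wt n q B := by
  unfold mCondProb
  rw [mProb_eq, mProb_eq, div_div_div_cancel_right₀ (mallowsZ_pos n q h0).ne']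

lemma SP {n : ℕ} (T : Fin n) (π : Equiv.Perm (Fin n)) (j : Fin n) (hj : T ≤ j) :
    (π * Equiv.swap T j).symm T < T ↔ π.symm T < T := by
  have : (π * Equiv.swap T j).symm T = Equiv.swap T j (π.symm T) := by
    rw [Equiv.symm_apply_eq]; simp
  rw [this, ← not_le, ← not_le, swap_ge hj]

theorem mallows_arc_chain_transition
    (n : ℕ) (q : ℝ) (h0 : 0 < q) (h1 : q < 1)
    (t : ℕ) (ht : t < n) (g : Finset (Fin n × Fin n))
    (hg : ∀ p ∈ g, (p.1 : ℕ) < t ∧ (p.2 : ℕ) < t)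
    (hpos : 0 < mProb n q (fun π =>
      graphP n π ∩
        Finset.univ.filter
          (fun p : Fin n × Fin n => (p.1 : ℕ) < t ∧ (p.2 : ℕ) < t) = g))
    (k : ℕ) (hk : k = t - g.card) :
    mCondProb n q (fun π => ((kappa n (t + 1) π : ℤ) = (k : ℤ) - 1))
        (fun π => graphP n π ∩
          Finset.univ.filter
            (fun p : Fin n × Fin n => (p.1 : ℕ) < t ∧ (p.2 : ℕ) < t) = g)
      = ((1 - q ^ k) / (1 - q ^ (n - t))) ^ 2 ∧
    mCondProb n q (fun π => kappa n (t + 1) π = k)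
        (fun π => graphP n π ∩
          Finset.univ.filter
            (fun p : Fin n × Fin n => (p.1 : ℕ) < t ∧ (p.2 : ℕ) < t) = g)
      = (q ^ k - q ^ (n - t)) / (1 - q ^ (n - t)) *
          ((2 - q ^ k - q ^ (k + 1)) / (1 - q ^ (n - t))) ∧
    mCondProb n q (fun π => kappa n (t + 1) π = k + 1)
        (fun π => graphP n π ∩
          Finset.univ.filter
            (fun p : Fin n × Fin n => (p.1 : ℕ) < t ∧ (p.2 : ℕ) < t) = g)
      = (q ^ k - q ^ (n - t)) / (1 - q ^ (n - t)) *
          ((q ^ (k + 1) - q ^ (n - t)) / (1 - q ^ (n - t))) ∧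
    ∀ π : Equiv.Perm (Fin n), ((kappa n (t + 1) π : ℤ) - (kappa n t π : ℤ)).natAbs ≤ 1 := by
  
  obtain ⟨T, rfl⟩ : ∃ T : Fin n, (T : ℕ) = t := ⟨⟨t, ht⟩, rfl⟩
  change 0 < mProb n q (ev n T g) at hpos
  change mCondProb n q _ (ev n T g) = _ ∧ mCondProb n q _ (ev n T g) = _ ∧
    mCondProb n q _ (ev n T g) = _ ∧ _
  have hW : 0 < wt n q (ev n T g) := by
    rw [mProb_eq] at hpos
    have := mul_pos hpos (mallowsZ_pos n q h0)
    rwa [div_mul_cancel₀ _ (mallowsZ_pos n q h0).ne'] at this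
  have hkm : k ≤ n - T := by
    by_contra hc
    rw [wt_false q] at hW
    · exact lt_irrefl _ hW
    · intro π h
      have h1 := ev_low T g π h
      have h2 := low_le T T π
      omega
  have hd : 0 < 1 - q ^ (n - (T : ℕ)) := by
    have := pow_lt_one₀ h0.le h1 (show n - (T : ℕ) ≠ 0 by omega)
    linarith
  have eS := wt_S q h1 T g k hk hkm
  have e1 := wt_main q h1 T (fun π => ev n T g π ∧ π.symm T < T)
    (fun π j hj => and_congr (ev_swap T g π j hj) (SP T π j hj)) k hkm
  have hP2 : ∀ π j, T ≤ j → ((ev n T g (π * Equiv.swap T j) ∧ ¬ (π * Equiv.swap T j).symm T < T)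
      ↔ (ev n T g π ∧ ¬ π.symm T < T)) :=
    fun π j hj => and_congr (ev_swap T g π j hj) (not_congr (SP T π j hj))
  have s1 := wt_split q (ev n T g) (fun π => π.symm T < T)
  have e2 : (1 - q ^ (n - (T : ℕ))) *
      wt n q (fun π => (ev n T g π ∧ ¬ π.symm T < T) ∧ rk T π T < k + 1)
      = (1 - q ^ (k + 1)) * wt n q (fun π => ev n T g π ∧ ¬ π.symm T < T) := by
    by_cases hk2 : k + 1 ≤ n - T
    · exact wt_main q h1 T (fun π => ev n T g π ∧ ¬ π.symm T < T) hP2 (k + 1) hk2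
    · have : ∀ π, ¬ (ev n T g π ∧ ¬ π.symm T < T) := by
        rintro π ⟨ha, hb⟩
        have h2 := ev_low T g π ha
        have h3 := low_succ T π
        have h4 := low_le T (T + 1) π
        rw [if_pos (not_lt.1 hb)] at h3
        omega
      rw [wt_false q this, wt_false q (fun π h => this π h.1)]
      simp
  have s2 := wt_split q (fun π => ev n T g π ∧ π.symm T < T) (fun π => rk T π T < k)
  have s3 := wt_split q (fun π => ev n T g π ∧ ¬ π.symm T < T) (fun π => rk T π T < k + 1)
  -- value of the chain at the next step
  have kS : ∀ π, ev n T g π → π.symm T < T → 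
      kappa n (T + 1) π + 1 = k + if rk T π T < k then 0 else 1 := by
    intro π h hS
    have a1 := kappa_succ T π
    have a2 := ev_kappa T g π h
    have a3 := ev_low T g π h
    have a4 := lt_iff_rk T (T + 1) π
    rw [low_succ, if_neg (not_le.2 hS), a3, add_zero, ← hk] at a4
    rw [a2, if_pos hS, ← hk] at a1
    rw [a1]
    congr 1
    by_cases hr : rk T π T < k
    · rw [if_pos hr, if_neg]
      rw [Fin.lt_def]
      have := a4.2 hr
      omega
    · rw [if_neg hr, if_pos]
      rw [Fin.lt_def]
      by_contra hc
      exact hr (a4.1 (by omega))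
  have kN : ∀ π, ev n T g π → ¬ π.symm T < T → 
      kappa n (T + 1) π = k + if rk T π T < k + 1 then 0 else 1 := by
    intro π h hS
    have a1 := kappa_succ T π
    have a2 := ev_kappa T g π h
    have a3 := ev_low T g π h
    have a4 := lt_iff_rk T (T + 1) π
    rw [low_succ, if_pos (not_lt.1 hS), a3, ← hk] at a4
    rw [a2, if_neg hS, ← hk, add_zero] at a1
    rw [a1]
    congr 1
    by_cases hr : rk T π T < k + 1
    · rw [if_pos hr, if_neg]
      rw [Fin.lt_def]
      have := a4.2 hr
      omega
    · rw [if_neg hr, if_pos]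
      rw [Fin.lt_def]
      by_contra hc
      exact hr (a4.1 (by omega))
  have hd' := hd.ne'
  have hW' := hW.ne'
  refine ⟨?_, ?_, ?_, ?_⟩
  · rw [mCond_eq q h0, wt_congr q
      (C := fun π => (ev n T g π ∧ π.symm T < T) ∧ rk T π T < k)]
    · rw [div_pow, div_eq_div_iff hW' (pow_ne_zero 2 hd')]
      linear_combination (1 - q ^ (n - (T : ℕ))) * e1 + (1 - q ^ k) * eS
    · intro π
      by_cases h : ev n T g π
      · by_cases hS : π.symm T < T
        · have := kS π h hS
          by_cases hr : rk T π T < k <;> simp [hr, h, hS] at this ⊢ <;> omega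
        · have := kN π h hS
          simp only [h, hS]
          split_ifs at this <;> simp <;> omega
      · simp [h]
  · rw [mCond_eq q h0, wt_split q _ (fun π => π.symm T < T), wt_congr q
      (A := fun π => _ ∧ π.symm T < T)
      (C := fun π => (ev n T g π ∧ π.symm T < T) ∧ ¬ rk T π T < k), wt_congr q
      (A := fun π => _ ∧ ¬ π.symm T < T)
      (C := fun π => (ev n T g π ∧ ¬ π.symm T < T) ∧ rk T π T < k + 1)]
    · rw [div_mul_div_comm, div_eq_div_iff hW' (mul_ne_zero hd' hd')]
      generalize wt n q (fun π => (ev n T g π ∧ π.symm T < T) ∧ rk T π T < k) = x1 at *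
      generalize wt n q (fun π => (ev n T g π ∧ π.symm T < T) ∧ ¬ rk T π T < k) = x2 at *
      generalize wt n q (fun π => (ev n T g π ∧ ¬ π.symm T < T) ∧ rk T π T < k + 1) = x3 at *
      generalize wt n q (fun π => (ev n T g π ∧ ¬ π.symm T < T) ∧ ¬ rk T π T < k + 1) = x4 at *
      generalize wt n q (fun π => ev n T g π ∧ π.symm T < T) = y1 at *
      generalize wt n q (fun π => ev n T g π ∧ ¬ π.symm T < T) = y2 at *
      generalize wt n q (fun π => ev n T g π) = w at *
      generalize q ^ (n - (T : ℕ)) = m at *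
      generalize q ^ (k + 1) = c at *
      generalize q ^ k = d at *
      have hx2 : x2 = y1 - x1 := by linarith
      have hy2 : y2 = w - y1 := by linarith
      subst hx2 hy2
      linear_combination (1 - m) * e2 - (1 - m) * e1 + ((1 - m) - (1 - c) - (1 - d)) * eS
    · intro π
      by_cases h : ev n T g π
      · by_cases hS : π.symm T < T
        · simp [hS]
        · have := kN π h hS
          by_cases hr : rk T π T < k + 1 <;> simp [hr, h, hS] at this ⊢ <;> omega
      · simp [h]
    · intro π
      by_cases h : ev n T g π
      · by_cases hS : π.symm T < T
        · have := kS π h hS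
          by_cases hr : rk T π T < k <;> simp [hr, h, hS] at this ⊢ <;> omega
        · simp [hS]
      · simp [h]
  · rw [mCond_eq q h0, wt_congr q
      (C := fun π => (ev n T g π ∧ ¬ π.symm T < T) ∧ ¬ rk T π T < k + 1)]
    · rw [div_mul_div_comm, div_eq_div_iff hW' (mul_ne_zero hd' hd')]
      generalize wt n q (fun π => (ev n T g π ∧ ¬ π.symm T < T) ∧ rk T π T < k + 1) = x3 at *
      generalize wt n q (fun π => (ev n T g π ∧ ¬ π.symm T < T) ∧ ¬ rk T π T < k + 1) = x4 at *
      generalize wt n q (fun π => ev n T g π ∧ π.symm T < T) = y1 at *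
      generalize wt n q (fun π => ev n T g π ∧ ¬ π.symm T < T) = y2 at *
      generalize wt n q (fun π => ev n T g π) = w at *
      generalize q ^ (n - (T : ℕ)) = m at *
      generalize q ^ (k + 1) = c at *
      generalize q ^ k = d at *
      have hx4 : x4 = y2 - x3 := by linarith
      have hy2 : y2 = w - y1 := by linarith
      subst hx4 hy2
      linear_combination -(1 - m) * e2 - ((1 - m) - (1 - c)) * eS
    · intro π
      by_cases h : ev n T g π
      · by_cases hS : π.symm T < T
        · have := kS π h hS
          by_cases hr : rk T π T < k <;> simp [hr, h, hS] at this ⊢ <;> omega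
        · have := kN π h hS
          by_cases hr : rk T π T < k + 1 <;> simp [hr, h, hS] at this ⊢ <;> omega
      · simp [h]
  · intro π
    have := kappa_succ T π
    split_ifs at this <;> omega
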